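/- Let G be a maxnil graph and let e = xy be a non-triangular edge of G. Then the graph obtained from G by adding one new vertex adjacent exactly to x and y is maxnil. -/

import Mathlib

open SimpleGraph

/-- `H` is a minor of `G`: there is a family of nonempty, pairwise disjoint,
connected branch sets in `G`, one for each vertex of `H`, with an edge of `G`
between the branch sets of any two adjacent vertices of `H`. -/
def IsMinor {W V : Type} (H : SimpleGraph W) (G : SimpleGraph V) : Prop :=
  ∃ f : W → Set V,
    (∀ w, (f w).Nonempty) ∧
    (∀ w, (G.induce (f w)).Connected) ∧
    (Pairwise fun w₁ w₂ => Disjoint (f w₁) (f w₂)) ∧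
    ∀ ⦃w₁ w₂⦄, H.Adj w₁ w₂ → ∃ v₁ ∈ f w₁, ∃ v₂ ∈ f w₂, G.Adj v₁ v₂

/-- The result of a `∇Y`-move on the triangle `a b c` of `G`: delete the edges of
the triangle and add a new vertex (`none`) joined to `a`, `b`, `c`. -/
def triangleY {V : Type} (G : SimpleGraph V) (a b c : V) : SimpleGraph (Option V) :=
  (SimpleGraph.map Function.Embedding.some
      (G.deleteEdges {s(a, b), s(b, c), s(a, c)})) ⊔
    SimpleGraph.fromEdgeSet {s((none : Option V), some a), s(none, some b), s(none, some c)}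

/-- Membership in the Petersen family: the graphs obtained from `K₆` by
`∇Y`-moves and `Y∇`-moves (the inverse operation), up to isomorphism. -/
inductive IsPetersenFamily : ∀ {V : Type}, SimpleGraph V → Prop
  | k6 : IsPetersenFamily (⊤ : SimpleGraph (Fin 6))
  | deltaY {V : Type} {G : SimpleGraph V} {a b c : V} :
      IsPetersenFamily G → G.Adj a b → G.Adj b c → G.Adj a c →
      IsPetersenFamily (triangleY G a b c)
  | yDelta {V : Type} {G : SimpleGraph V} {a b c : V} :
      IsPetersenFamily (triangleY G a b c) → G.Adj a b → G.Adj b c → G.Adj a c →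
      IsPetersenFamily G
  | iso {V W : Type} {G : SimpleGraph V} {H : SimpleGraph W} :
      IsPetersenFamily G → G ≃g H → IsPetersenFamily H

/-- A graph is linklessly embeddable (nIL) iff it has no minor in the Petersen family. -/
def IsLinkless {V : Type} (G : SimpleGraph V) : Prop :=
  ∀ ⦃W : Type⦄ (P : SimpleGraph W), IsPetersenFamily P → ¬ IsMinor P G

/-- The graph obtained from `G` by adding the edge `ab`. -/
def addEdge {V : Type} (G : SimpleGraph V) (a b : V) : SimpleGraph V :=
  G ⊔ SimpleGraph.fromEdgeSet {s(a, b)}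

/-- A nIL graph is maxnil if adding any edge yields a graph that is not nIL. -/
def IsMaxnil {V : Type} (G : SimpleGraph V) : Prop :=
  IsLinkless G ∧ ∀ a b : V, a ≠ b → ¬ G.Adj a b → ¬ IsLinkless (addEdge G a b)

/-- `S` is a vertex cut set of the connected graph `G` if `G - S` is disconnected. -/
def IsVertexCut {V : Type} (G : SimpleGraph V) (S : Set V) : Prop :=
  G.Connected ∧ ¬ (G.induce Sᶜ).Preconnected

/-- A vertex cut set is minimal if no proper subset of it is a vertex cut set. -/
def IsMinimalVertexCut {V : Type} (G : SimpleGraph V) (S : Set V) : Prop :=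
  IsVertexCut G S ∧ ∀ S' ⊂ S, ¬ IsVertexCut G S'

/-- A set `T` of vertices of `H` (inducing a `K₄`) is strongly separating if `H - T`
has at least two connected components such that every vertex of `T` has a
neighbor in each of them. -/
def StronglySeparating {V : Type} (H : SimpleGraph V) (T : Set V) : Prop :=
  ∃ C₁ C₂ : (H.induce Tᶜ).ConnectedComponent, C₁ ≠ C₂ ∧
    ∀ v ∈ T, (∃ u ∈ C₁.supp, H.Adj v ↑u) ∧ (∃ u ∈ C₂.supp, H.Adj v ↑u)

/-- `G` is maximal without a `K₆` minor. -/
def IsMaximalK6MinorFree {V : Type} (G : SimpleGraph V) : Prop :=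
  ¬ IsMinor (⊤ : SimpleGraph (Fin 6)) G ∧
    ∀ a b : V, a ≠ b → ¬ G.Adj a b → IsMinor (⊤ : SimpleGraph (Fin 6)) (addEdge G a b)

namespace Petersen

/-- Vertex lists of the seven graphs of the Petersen family. -/
def verts : ℕ → List ℕ
  | 0 => [0, 1, 2, 3, 4, 5]
  | 1 => [0, 1, 2, 3, 4, 5, 6]
  | 2 => [0, 1, 2, 3, 4, 5, 6]
  | 3 => [0, 1, 2, 3, 4, 5, 6, 7]
  | 4 => [0, 1, 2, 3, 4, 5, 6, 7]
  | 5 => [0, 1, 2, 3, 4, 5, 6, 7, 8]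
  | 6 => [0, 1, 2, 3, 4, 5, 6, 7, 8, 9]
  | _ => []

/-- Number of vertices. -/
def size : ℕ → ℕ
  | 0 => 6
  | 1 => 7
  | 2 => 7
  | 3 => 8
  | 4 => 8
  | 5 => 9
  | 6 => 10
  | _ => 0

/-- Vertex lists with one more vertex. -/
def vertsS : ℕ → List ℕ
  | 0 => [0, 1, 2, 3, 4, 5, 6]
  | 1 => [0, 1, 2, 3, 4, 5, 6, 7]
  | 2 => [0, 1, 2, 3, 4, 5, 6, 7]
  | 3 => [0, 1, 2, 3, 4, 5, 6, 7, 8]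
  | 4 => [0, 1, 2, 3, 4, 5, 6, 7, 8]
  | 5 => [0, 1, 2, 3, 4, 5, 6, 7, 8, 9]
  | 6 => [0, 1, 2, 3, 4, 5, 6, 7, 8, 9, 10]
  | _ => [0]

/-- Adjacency matrices (entry `(i, j)` is bit `10 * i + j`). -/
def code : ℕ → ℕ
  | 0 => 34954633276355646
  | 1 => 8105405165588308088
  | 2 => 72714071825304379512
  | 3 => 29522896054061939941600
  | 4 => 66121353355773855522936
  | 5 => 50804407596840102731792608
  | 6 => 64423686450991080519674183904
  | _ => 0

def adj (k i j : ℕ) : Bool := Nat.testBit (code k) (10 * i + j)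

/-- Adjacency after a delta-Y move. -/
def dY (k a b c u v : ℕ) : Bool :=
  if u = size k then (v == a || v == b || v == c)
  else if v = size k then (u == a || u == b || u == c)
  else adj k u v && !((u == a || u == b || u == c) && (v == a || v == b || v == c))

/-- Adjacency after a Y-delta move at `z`. -/
def yD (k z u v : ℕ) : Bool :=
  !(u == v) && (adj k u v || (adj k z u && adj k z v))

def deg (L : List ℕ) (s : ℕ → ℕ → Bool) (u : ℕ) : ℕ := (L.filter (s u)).length

/-- Backtracking isomorphism search. -/
def srch (s t : ℕ → ℕ → Bool) (L cands : List ℕ) : List ℕ → List (ℕ × ℕ) → Option (List (ℕ × ℕ))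
  | [], acc => some acc
  | u :: us, acc => cands.findSome? fun w =>
      if (acc.all fun p => !(p.2 == w) && (s u p.1 == t w p.2)) && (deg L s u == deg cands t w)
      then srch s t L cands us ((u, w) :: acc) else none

def look (M : List (ℕ × ℕ)) (u : ℕ) : ℕ := (M.lookup u).getD 0

def okMap (L : List ℕ) (s : ℕ → ℕ → Bool) (k : ℕ) (M : List (ℕ × ℕ)) : Bool :=
  (L.all fun u => (verts k).contains (look M u) &&
    L.all fun v => (look M u == look M v) == (u == v) && s u v == adj k (look M u) (look M v)) &&
  (verts k).all fun w => L.any fun u => look M u == w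

def good (L : List ℕ) (s : ℕ → ℕ → Bool) : Bool :=
  [0, 1, 2, 3, 4, 5, 6].any fun k =>
    L.length == size k &&
      match srch s (adj k) L (verts k) L [] with
      | none => false
      | some M => okMap L s k M

def dCheck (k : ℕ) : Bool :=
  (verts k).all fun a => (verts k).all fun b => !(adj k a b) || (verts k).all fun c =>
    !(adj k b c && adj k a c) || good (vertsS k) (dY k a b c)

def yCheck (k : ℕ) : Bool :=
  (verts k).all fun z => !(deg (verts k) (adj k) z == 3) ||
    good ((verts k).filter fun u => !(u == z)) (yD k z)

def mCheck (k : ℕ) : Bool :=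
  (verts k).all fun z => (verts k).any fun a => adj k z a && (verts k).any fun b =>
    (!(a == b) && adj k z b) && (verts k).any fun c => !(a == c) && !(b == c) && adj k z c

set_option maxRecDepth 100000 in
theorem dCheck_all : ([0, 1, 2, 3, 4, 5, 6].all dCheck) = true := by decide +kernel

set_option maxRecDepth 100000 in
theorem yCheck_all : ([0, 1, 2, 3, 4, 5, 6].all yCheck) = true := by decide +kernel

set_option maxRecDepth 100000 in
theorem mCheck_all : ([0, 1, 2, 3, 4, 5, 6].all mCheck) = true := by decide +kernel

/-- `G` is represented by the `k`-th graph. -/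
def Rep {V : Type} (L : List ℕ) (s : ℕ → ℕ → Bool) (G : SimpleGraph V) : Prop :=
  ∃ f : V → ℕ, Function.Injective f ∧ (∀ i, i ∈ L ↔ ∃ v, f v = i) ∧
    ∀ u v, G.Adj u v ↔ s (f u) (f v) = true

def InFam {V : Type} (G : SimpleGraph V) : Prop :=
  ∃ k ∈ [0, 1, 2, 3, 4, 5, 6], Rep (verts k) (adj k) G

theorem inFam_of_good {V : Type} {G : SimpleGraph V} {L : List ℕ} {s : ℕ → ℕ → Bool}
    (h : good L s = true) (hr : Rep L s G) : InFam G := by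
  obtain ⟨f, hf, hL, hs⟩ := hr
  unfold good at h
  rw [List.any_eq_true] at h
  obtain ⟨k, hk, h⟩ := h
  refine ⟨k, hk, ?_⟩
  rw [Bool.and_eq_true] at h
  replace h := h.2
  cases hM : srch s (adj k) L (verts k) L [] with
  | none => rw [hM] at h; simp at h
  | some M =>
    rw [hM] at h
    simp only [okMap, Bool.and_eq_true, List.all_eq_true, List.any_eq_true, beq_iff_eq,
      List.contains_iff_mem] at h
    obtain ⟨h1, h2⟩ := h
    have hm : ∀ v, f v ∈ L := fun v => (hL _).2 ⟨v, rfl⟩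
    refine ⟨fun v => look M (f v), ?_, ?_, ?_⟩
    · intro u v huv
      have h3 := ((h1 _ (hm u)).2 _ (hm v)).1
      apply hf
      simp only at huv
      rw [huv] at h3
      simpa using h3
    · intro i
      constructor
      · intro hi
        obtain ⟨u, hu, he⟩ := h2 i hi
        obtain ⟨v, rfl⟩ := (hL u).1 hu
        exact ⟨v, he⟩
      · rintro ⟨v, rfl⟩
        exact (h1 _ (hm v)).1
    · intro u v
      rw [hs, ((h1 _ (hm u)).2 _ (hm v)).2]

theorem mem_vertsS {k : ℕ} (hk : k ∈ [0, 1, 2, 3, 4, 5, 6]) (i : ℕ) :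
    i ∈ vertsS k ↔ i = size k ∨ i ∈ verts k := by
  fin_cases hk <;> simp [vertsS, verts, size] <;> omega

theorem size_notMem {k : ℕ} (hk : k ∈ [0, 1, 2, 3, 4, 5, 6]) : size k ∉ verts k := by
  fin_cases hk <;> simp [verts, size]

theorem verts_nodup {k : ℕ} (hk : k ∈ [0, 1, 2, 3, 4, 5, 6]) : (verts k).Nodup := by
  fin_cases hk <;> simp [verts]

theorem triangleY_some {V : Type} (G : SimpleGraph V) (a b c u v : V) :
    (triangleY G a b c).Adj (some u) (some v) ↔
      G.Adj u v ∧ ¬ ((u = a ∨ u = b ∨ u = c) ∧ (v = a ∨ v = b ∨ v = c)) := by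
  simp only [triangleY, SimpleGraph.sup_adj, SimpleGraph.map_adj, SimpleGraph.deleteEdges_adj,
    SimpleGraph.fromEdgeSet_adj]
  constructor
  · rintro (⟨u', v', ⟨h, h'⟩, h1, h2⟩ | ⟨h, -⟩)
    · simp only [Function.Embedding.some_apply, Option.some.injEq] at h1 h2
      subst h1 h2
      refine ⟨h, fun h3 => h' ?_⟩
      have hne := h.ne
      simp only [Set.mem_insert_iff, Set.mem_singleton_iff, Sym2.eq_iff]
      grind
    · simp at h
  · rintro ⟨h, h'⟩
    refine Or.inl ⟨u, v, ⟨h, fun h3 => h' ?_⟩, rfl, rfl⟩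
    simp only [Set.mem_insert_iff, Set.mem_singleton_iff, Sym2.eq_iff] at h3
    grind

theorem triangleY_none {V : Type} (G : SimpleGraph V) (a b c v : V) :
    (triangleY G a b c).Adj none (some v) ↔ (v = a ∨ v = b ∨ v = c) := by
  simp only [triangleY, SimpleGraph.sup_adj, SimpleGraph.map_adj, SimpleGraph.deleteEdges_adj,
    SimpleGraph.fromEdgeSet_adj]
  simp

theorem inFam_deltaY {V : Type} {G : SimpleGraph V} {a b c : V} (h : InFam G)
    (hab : G.Adj a b) (hbc : G.Adj b c) (hac : G.Adj a c) : InFam (triangleY G a b c) := by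
  obtain ⟨k, hk, f, hf, hL, hs⟩ := h
  have hm : ∀ v, f v ∈ verts k := fun v => (hL _).2 ⟨v, rfl⟩
  have hne : ∀ v, f v ≠ size k := fun v hv => size_notMem hk (hv ▸ hm v)
  have hc := List.all_eq_true.1 dCheck_all k hk
  simp only [dCheck, List.all_eq_true, Bool.or_eq_true, Bool.not_eq_true'] at hc
  have hc' := ((hc _ (hm a) _ (hm b)).resolve_left (by simp [(hs _ _).1 hab]) _ (hm c)).resolve_left
    (by simp [(hs _ _).1 hbc, (hs _ _).1 hac])
  refine inFam_of_good hc' ⟨fun o => o.elim (size k) f, ?_, ?_, ?_⟩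
  · rintro (_ | u) (_ | v) h
    · rfl
    · exact absurd h.symm (hne v)
    · exact absurd h (hne u)
    · exact congrArg some (hf h)
  · intro i
    rw [mem_vertsS hk, hL]
    constructor
    · rintro (rfl | ⟨v, rfl⟩)
      · exact ⟨none, rfl⟩
      · exact ⟨some v, rfl⟩
    · rintro ⟨_ | v, rfl⟩
      · exact Or.inl rfl
      · exact Or.inr ⟨v, rfl⟩
  · rintro (_ | u) (_ | v)
    · have := hne a
      have := hne b
      have := hne c
      simp [dY]
      grind
    · rw [triangleY_none]
      simp [dY, hf.eq_iff, or_assoc]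
    · rw [SimpleGraph.adj_comm, triangleY_none]
      simp [dY, hf.eq_iff, or_assoc, hne]
    · rw [triangleY_some, hs]
      simp only [dY, Option.elim_some, hne, if_false, Bool.and_eq_true, Bool.not_eq_true',
        beq_eq_decide, hf.eq_iff, ← Bool.not_eq_true, Bool.or_eq_true, decide_eq_true_eq,
        or_assoc]

theorem inFam_yDelta {V : Type} {G : SimpleGraph V} {a b c : V} (h : InFam (triangleY G a b c))
    (hab : G.Adj a b) (hbc : G.Adj b c) (hac : G.Adj a c) : InFam G := by
  obtain ⟨k, hk, f, hf, hL, hs⟩ := h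
  have hm : ∀ v, f v ∈ verts k := fun v => (hL _).2 ⟨v, rfl⟩
  have hc := List.all_eq_true.1 yCheck_all k hk
  simp only [yCheck, List.all_eq_true, Bool.or_eq_true, Bool.not_eq_true'] at hc
  have hd : deg (verts k) (adj k) (f none) = 3 := by
    unfold deg
    have hnd : ((verts k).filter (adj k (f none))).Nodup := (verts_nodup hk).filter _
    rw [← List.toFinset_card_of_nodup hnd]
    have : ((verts k).filter (adj k (f none))).toFinset
        = {f (some a), f (some b), f (some c)} := by
      ext i
      simp only [List.mem_toFinset, List.mem_filter, hL, Finset.mem_insert, Finset.mem_singleton]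
      constructor
      · rintro ⟨⟨_ | v, rfl⟩, h⟩
        · rw [← hs] at h
          exact absurd h (SimpleGraph.irrefl _)
        · rw [← hs, triangleY_none] at h
          rcases h with rfl | rfl | rfl <;> simp
      · rintro (rfl | rfl | rfl) <;> refine ⟨⟨_, rfl⟩, ?_⟩ <;> rw [← hs, triangleY_none] <;> simp
    rw [this, Finset.card_eq_three]
    refine ⟨_, _, _, ?_, ?_, ?_, rfl⟩ <;> intro h <;> have := Option.some.inj (hf h)
    · exact hab.ne this
    · exact hac.ne this
    · exact hbc.ne this
  have hc' := (hc _ (hm none)).resolve_left (by simp [hd])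
  refine inFam_of_good hc' ⟨fun v => f (some v), ?_, ?_, ?_⟩
  · intro u v h
    exact Option.some.inj (hf h)
  · intro i
    simp only [List.mem_filter, hL]
    constructor
    · rintro ⟨⟨_ | v, rfl⟩, h⟩
      · simp at h
      · exact ⟨v, rfl⟩
    · rintro ⟨v, rfl⟩
      refine ⟨⟨_, rfl⟩, ?_⟩
      simp [hf.eq_iff]
  · intro u v
    simp only [yD, Bool.and_eq_true, Bool.or_eq_true, ← hs, triangleY_some, triangleY_none]
    simp only [Bool.not_eq_true', beq_eq_decide, hf.eq_iff, decide_eq_false_iff_not,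
      Option.some.injEq]
    have hba := hab.symm
    have hcb := hbc.symm
    have hca := hac.symm
    constructor
    · intro h
      have := h.ne
      tauto
    · rintro ⟨h1, h2 | ⟨h2, h3⟩⟩
      · exact h2.1
      · rcases h2 with rfl | rfl | rfl <;> rcases h3 with rfl | rfl | rfl <;>
          first | exact absurd rfl h1 | assumption

theorem inFam_k6 : InFam (⊤ : SimpleGraph (Fin 6)) := by
  refine ⟨0, by simp, fun i => i.val, Fin.val_injective, ?_, ?_⟩
  · intro i
    constructor
    · intro h
      have : i < 6 := by
        simp [verts] at h
        omega
      exact ⟨⟨i, this⟩, rfl⟩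
    · rintro ⟨v, rfl⟩
      fin_cases v <;> simp [verts]
  · have : ∀ u v : Fin 6, u ≠ v ↔ adj 0 u.val v.val = true := by decide +kernel
    simpa using this

theorem inFam {V : Type} {G : SimpleGraph V} (h : IsPetersenFamily G) : InFam G := by
  induction h with
  | k6 => exact inFam_k6
  | deltaY _ h1 h2 h3 ih => exact inFam_deltaY ih h1 h2 h3
  | yDelta _ h1 h2 h3 ih => exact inFam_yDelta ih h1 h2 h3
  | iso _ e ih =>
    obtain ⟨k, hk, f, hf, hL, hs⟩ := ih
    refine ⟨k, hk, f ∘ e.symm, hf.comp e.symm.injective, ?_, ?_⟩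
    · intro i
      rw [hL]
      exact (e.symm.surjective.exists (p := fun v => f v = i))
    · intro u v
      rw [Function.comp, Function.comp, ← hs, e.symm.map_adj_iff]

/-- Graphs in the Petersen family have minimum degree at least three. -/
theorem three_neighbors {W : Type} {P : SimpleGraph W} (h : IsPetersenFamily P) (w : W) :
    ∃ a b c, a ≠ b ∧ a ≠ c ∧ b ≠ c ∧ P.Adj w a ∧ P.Adj w b ∧ P.Adj w c := by
  obtain ⟨k, hk, f, hf, hL, hs⟩ := inFam h
  have hm : ∀ v, f v ∈ verts k := fun v => (hL _).2 ⟨v, rfl⟩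
  have hc := List.all_eq_true.1 mCheck_all k hk
  simp only [mCheck, List.all_eq_true, List.any_eq_true, Bool.and_eq_true, hL] at hc
  obtain ⟨_, ⟨a, rfl⟩, ha, _, ⟨b, rfl⟩, ⟨hab, hb⟩, _, ⟨c, rfl⟩, ⟨hac, hbc⟩, hcc⟩ :=
    hc (f w) ⟨w, rfl⟩
  rw [← hs] at ha hb hcc
  refine ⟨a, b, c, ?_, ?_, ?_, ha, hb, hcc⟩ <;> rintro rfl
  · simp at hab
  · simp at hac
  · simp at hbc

end Petersen

/-- A map sending adjacent vertices to equal or adjacent ones preserves reachability. -/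
theorem reachable_of_map {A B : Type} {H : SimpleGraph A} {K : SimpleGraph B} (r : A → B)
    (hr : ∀ u v, H.Adj u v → K.Reachable (r u) (r v)) {u v : A} (h : H.Reachable u v) :
    K.Reachable (r u) (r v) := by
  obtain ⟨p⟩ := h
  induction p with
  | nil => exact SimpleGraph.Reachable.refl _
  | cons h _ ih => exact (hr _ _ h).trans ih

theorem IsMinor.trans' {A B C : Type} {P : SimpleGraph A} {H : SimpleGraph B} {K : SimpleGraph C}
    (h1 : IsMinor P H) (h2 : IsMinor H K) : IsMinor P K := by
  obtain ⟨f, fne, fc, fd, fa⟩ := h1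
  obtain ⟨g, gne, gc, gd, ga⟩ := h2
  refine ⟨fun w => ⋃ v ∈ f w, g v, ?_, ?_, ?_, ?_⟩
  · intro w
    obtain ⟨v, hv⟩ := fne w
    obtain ⟨z, hz⟩ := gne v
    exact ⟨z, Set.mem_biUnion hv hz⟩
  · intro w
    have sub : ∀ v ∈ f w, g v ⊆ ⋃ v ∈ f w, g v := fun v hv => Set.subset_biUnion_of_mem hv
    have key : ∀ v (hv : v ∈ f w) z (hz : z ∈ g v) z' (hz' : z' ∈ g v),
        (K.induce (⋃ v ∈ f w, g v)).Reachable ⟨z, sub v hv hz⟩ ⟨z', sub v hv hz'⟩ := by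
      intro v hv z hz z' hz'
      have := (gc v).preconnected ⟨z, hz⟩ ⟨z', hz'⟩
      exact reachable_of_map (K := K.induce (⋃ v ∈ f w, g v))
        (fun q : g v => (⟨q.1, sub v hv q.2⟩ : ↥(⋃ v ∈ f w, g v)))
        (fun u v h => SimpleGraph.Adj.reachable h) this
    choose p hp using gne
    have key2 : ∀ v v' : f w, (K.induce (⋃ v ∈ f w, g v)).Reachable
        ⟨p v, sub v v.2 (hp v)⟩ ⟨p v', sub v' v'.2 (hp v')⟩ := by
      intro v v'
      refine reachable_of_map (H := H.induce (f w)) (K := K.induce (⋃ v ∈ f w, g v))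
        (fun v : f w => ⟨p v, sub v v.2 (hp v)⟩) ?_ ((fc w).preconnected v v')
      intro u v huv
      obtain ⟨z, hz, z', hz', hzz⟩ := ga huv
      refine (key u u.2 _ (hp u) z hz).trans (SimpleGraph.Reachable.trans ?_ (key v v.2 z' hz' _ (hp v)))
      exact SimpleGraph.Adj.reachable hzz
    obtain ⟨v0, hv0⟩ := fne w
    refine (SimpleGraph.connected_iff _).2 ⟨?_, ⟨⟨p v0, sub v0 hv0 (hp v0)⟩⟩⟩
    rintro ⟨z, hz⟩ ⟨z', hz'⟩
    obtain ⟨v, hv, hzv⟩ := Set.mem_iUnion₂.1 hz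
    obtain ⟨v', hv', hzv'⟩ := Set.mem_iUnion₂.1 hz'
    exact (key v hv z hzv _ (hp v)).trans ((key2 ⟨v, hv⟩ ⟨v', hv'⟩).trans (key v' hv' _ (hp v') z' hzv'))
  · intro w w' hw
    rw [Set.disjoint_left]
    intro z hz hz'
    obtain ⟨v, hv, hzv⟩ := Set.mem_iUnion₂.1 hz
    obtain ⟨v', hv', hzv'⟩ := Set.mem_iUnion₂.1 hz'
    by_cases hvv : v = v'
    · subst hvv
      exact Set.disjoint_left.1 (fd hw) hv hv'
    · exact Set.disjoint_left.1 (gd hvv) hzv hzv'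
  · intro w w' hw
    obtain ⟨v, hv, v', hv', h⟩ := fa hw
    obtain ⟨z, hz, z', hz', h'⟩ := ga h
    exact ⟨z, Set.mem_biUnion hv hz, z', Set.mem_biUnion hv' hz', h'⟩

theorem not_linkless_of_minor {A B : Type} {H : SimpleGraph A} {K : SimpleGraph B}
    (h : IsMinor H K) (hH : ¬ IsLinkless H) : ¬ IsLinkless K := by
  intro hK
  exact hH fun W P hP hPH => hK P hP (hPH.trans' h)

/-- The graph with the new vertex. -/
abbrev addV {V : Type} (G : SimpleGraph V) (x y : V) : SimpleGraph (Option V) :=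
  (SimpleGraph.map Function.Embedding.some G) ⊔
    SimpleGraph.fromEdgeSet {s((none : Option V), some x), s(none, some y)}

theorem addV_some {V : Type} (G : SimpleGraph V) (x y u v : V) :
    (addV G x y).Adj (some u) (some v) ↔ G.Adj u v := by
  simp only [addV, SimpleGraph.sup_adj, SimpleGraph.map_adj, SimpleGraph.fromEdgeSet_adj]
  simp

theorem addV_none {V : Type} (G : SimpleGraph V) (x y v : V) :
    (addV G x y).Adj none (some v) ↔ v = x ∨ v = y := by
  simp only [addV, SimpleGraph.sup_adj, SimpleGraph.map_adj, SimpleGraph.fromEdgeSet_adj]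
  simp

theorem addV_comm {V : Type} (G : SimpleGraph V) (x y : V) : addV G x y = addV G y x := by
  simp only [addV, Set.pair_comm]

theorem addEdge_adj' {V : Type} (G : SimpleGraph V) (a b u v : V) :
    (addEdge G a b).Adj u v ↔ G.Adj u v ∨ (u ≠ v ∧ (u = a ∧ v = b ∨ u = b ∧ v = a)) := by
  simp [addEdge]
  tauto

theorem addEdge_comm' {V : Type} (G : SimpleGraph V) (a b : V) :
    addEdge G a b = addEdge G b a := by
  simp only [addEdge, Sym2.eq_swap]

theorem linkless_addV {V : Type} (G : SimpleGraph V) (x y : V) (hG : IsLinkless G)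
    (he : G.Adj x y) : IsLinkless (addV G x y) := by
  rintro W P hP ⟨f, fne, fc, fd, fa⟩
  have nb : ∀ o, (addV G x y).Adj none o → o = some x ∨ o = some y := by
    rintro (_ | v) h
    · exact absurd h (SimpleGraph.irrefl _)
    · rw [addV_none] at h
      simpa using h
  have hne : ∀ w, ∃ v, some v ∈ f w := by
    intro w
    by_contra hcon
    push Not at hcon
    have hn : ∀ o ∈ f w, o = none := by
      rintro (_ | v) h
      · rfl
      · exact absurd h (hcon v)
    have hw : ∀ a, P.Adj w a → some x ∈ f a ∨ some y ∈ f a := by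
      intro a ha
      obtain ⟨v, hv, v', hv', h⟩ := fa ha
      rw [hn v hv] at h
      rcases nb _ h with rfl | rfl
      · exact Or.inl hv'
      · exact Or.inr hv'
    obtain ⟨a, b, c, hab, hac, hbc, ha, hb, hc⟩ := Petersen.three_neighbors hP w
    have d1 : ∀ {o}, o ∈ f a → o ∉ f b := fun {o} ho => Set.disjoint_left.1 (fd hab) ho
    have d2 : ∀ {o}, o ∈ f a → o ∉ f c := fun {o} ho => Set.disjoint_left.1 (fd hac) ho
    have d3 : ∀ {o}, o ∈ f b → o ∉ f c := fun {o} ho => Set.disjoint_left.1 (fd hbc) ho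
    rcases hw a ha with h1 | h1 <;> rcases hw b hb with h2 | h2 <;> rcases hw c hc with h3 | h3
    all_goals first | exact d1 h1 h2 | exact d2 h1 h3 | exact d3 h2 h3
  have hxy : ∀ w, none ∈ f w → some x ∈ f w ∨ some y ∈ f w := by
    intro w hw
    obtain ⟨v, hv⟩ := hne w
    obtain ⟨p⟩ := (fc w).preconnected ⟨none, hw⟩ ⟨some v, hv⟩
    cases p with
    | @cons _ q _ h _ =>
      obtain ⟨q, hq⟩ := q
      have h' : (addV G x y).Adj none q := h
      rcases nb _ h' with rfl | rfl
      · exact Or.inl hq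
      · exact Or.inr hq
  refine hG P hP ⟨fun w => {v | some v ∈ f w}, hne, ?_, ?_, ?_⟩
  · intro w
    obtain ⟨v0, hv0⟩ := hne w
    refine (SimpleGraph.connected_iff _).2 ⟨?_, ⟨⟨v0, hv0⟩⟩⟩
    have hr : ∃ r : f w → {v | some v ∈ f w}, (∀ v (hv : some v ∈ f w), r ⟨some v, hv⟩ = ⟨v, hv⟩) ∧
        ∀ h : none ∈ f w, (r ⟨none, h⟩).1 = x ∨ (r ⟨none, h⟩).1 = y := by
      by_cases hn : none ∈ f w
      · have : ∃ z : {v | some v ∈ f w}, z.1 = x ∨ z.1 = y := by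
          rcases hxy w hn with h | h
          · exact ⟨⟨x, h⟩, Or.inl rfl⟩
          · exact ⟨⟨y, h⟩, Or.inr rfl⟩
        obtain ⟨z, hz⟩ := this
        exact ⟨fun o => match o with
          | ⟨none, _⟩ => z
          | ⟨some v, hv⟩ => ⟨v, hv⟩, fun v hv => rfl, fun _ => hz⟩
      · exact ⟨fun o => match o with
          | ⟨none, h⟩ => absurd h hn
          | ⟨some v, hv⟩ => ⟨v, hv⟩, fun v hv => rfl, fun h => absurd h hn⟩
    obtain ⟨r, hr1, hr2⟩ := hr
    have hedge : ∀ p q : {v | some v ∈ f w}, (p.1 = x ∨ p.1 = y) → (q.1 = x ∨ q.1 = y) →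
        (G.induce {v | some v ∈ f w}).Reachable p q := by
      intro p q hp hq
      by_cases hpq : p = q
      · rw [hpq]
      · have hpq' : p.1 ≠ q.1 := fun h => hpq (Subtype.ext h)
        apply SimpleGraph.Adj.reachable
        change G.Adj p.1 q.1
        rcases hp with hp | hp <;> rcases hq with hq | hq
        · exact absurd (hp.trans hq.symm) hpq'
        · rw [hp, hq]; exact he
        · rw [hp, hq]; exact he.symm
        · exact absurd (hp.trans hq.symm) hpq'
    have hstep : ∀ u v : f w, ((addV G x y).induce (f w)).Adj u v →
        (G.induce {v | some v ∈ f w}).Reachable (r u) (r v) := by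
      rintro ⟨_ | u, hu⟩ ⟨_ | v, hv⟩ h
      · exact absurd h (SimpleGraph.irrefl _)
      · have h' : (addV G x y).Adj none (some v) := h
        rw [addV_none] at h'
        exact hedge _ _ (hr2 hu) (by rw [hr1]; exact h')
      · have h' : (addV G x y).Adj none (some u) := SimpleGraph.Adj.symm h
        rw [addV_none] at h'
        exact hedge _ _ (by rw [hr1]; exact h') (hr2 hv)
      · have h' : (addV G x y).Adj (some u) (some v) := h
        rw [addV_some] at h'
        rw [hr1, hr1]
        exact SimpleGraph.Adj.reachable h'
    rintro ⟨u, hu⟩ ⟨v, hv⟩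
    have := reachable_of_map r hstep ((fc w).preconnected ⟨some u, hu⟩ ⟨some v, hv⟩)
    rwa [hr1, hr1] at this
  · intro w w' hw
    rw [Set.disjoint_left]
    intro v hv hv'
    exact Set.disjoint_left.1 (fd hw) hv hv'
  · have side : ∀ w w' v, w ≠ w' → none ∈ f w → some v ∈ f w' → (v = x ∨ v = y) →
        ∃ u, some u ∈ f w ∧ G.Adj u v := by
      intro w w' v hw hn hv h
      have d : ∀ {o}, o ∈ f w → o ∉ f w' := fun {o} ho => Set.disjoint_left.1 (fd hw) ho
      rcases h with rfl | rfl <;> rcases hxy w hn with h1 | h1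
      · exact absurd hv (d h1)
      · exact ⟨_, h1, he.symm⟩
      · exact ⟨_, h1, he⟩
      · exact absurd hv (d h1)
    intro w w' hw
    obtain ⟨u, hu, v, hv, h⟩ := fa hw
    rcases u with _ | u <;> rcases v with _ | v
    · exact absurd h (SimpleGraph.irrefl _)
    · rw [addV_none] at h
      obtain ⟨u, hu', h'⟩ := side w w' v hw.ne hu hv h
      exact ⟨u, hu', v, hv, h'⟩
    · rw [SimpleGraph.adj_comm, addV_none] at h
      obtain ⟨v, hv', h'⟩ := side w' w u hw.ne' hv hu h
      exact ⟨u, hu, v, hv', h'.symm⟩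
    · rw [addV_some] at h
      exact ⟨u, hu, v, hv, h⟩

/-- Contracting the new edge from `none` to `b` gives all edges of `G + bx`. -/
theorem minor_contract {V : Type} (G : SimpleGraph V) (x y b : V) :
    IsMinor (addEdge G b x) (addEdge (addV G x y) none (some b)) := by
  refine ⟨fun v => {o | o = some v ∨ (o = none ∧ v = b)}, fun v => ⟨some v, Or.inl rfl⟩, ?_, ?_, ?_⟩
  · intro v
    refine (SimpleGraph.connected_iff _).2 ⟨?_, ⟨⟨some v, Or.inl rfl⟩⟩⟩
    have key : ∀ o : {o | o = some v ∨ (o = none ∧ v = b)},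
        ((addEdge (addV G x y) none (some b)).induce _).Reachable o ⟨some v, Or.inl rfl⟩ := by
      rintro ⟨o, rfl | ⟨rfl, rfl⟩⟩
      · exact SimpleGraph.Reachable.refl _
      · apply SimpleGraph.Adj.reachable
        change (addEdge (addV G x y) none (some v)).Adj none (some v)
        rw [addEdge_adj']
        exact Or.inr ⟨by simp, Or.inl ⟨rfl, rfl⟩⟩
    intro o o'
    exact (key o).trans (key o').symm
  · intro u v huv
    rw [Set.disjoint_left]
    rintro o (rfl | ⟨rfl, rfl⟩) (h | ⟨h, h'⟩)
    · exact huv (Option.some.inj h)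
    · simp at h
    · simp at h
    · exact huv h'.symm
  · intro u v h
    rw [addEdge_adj'] at h
    rcases h with h | ⟨-, ⟨rfl, rfl⟩ | ⟨rfl, rfl⟩⟩
    · refine ⟨some u, Or.inl rfl, some v, Or.inl rfl, ?_⟩
      rw [addEdge_adj', addV_some]
      exact Or.inl h
    · refine ⟨none, Or.inr ⟨rfl, rfl⟩, some v, Or.inl rfl, ?_⟩
      rw [addEdge_adj', addV_none]
      exact Or.inl (Or.inl rfl)
    · refine ⟨some u, Or.inl rfl, none, Or.inr ⟨rfl, rfl⟩, ?_⟩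
      rw [SimpleGraph.adj_comm, addEdge_adj', addV_none]
      exact Or.inl (Or.inl rfl)

theorem minor_some {V : Type} (G : SimpleGraph V) (x y a b : V) :
    IsMinor (addEdge G a b) (addEdge (addV G x y) (some a) (some b)) := by
  refine ⟨fun v => {some v}, fun v => ⟨some v, rfl⟩, ?_, ?_, ?_⟩
  · intro v
    refine (SimpleGraph.connected_iff _).2 ⟨?_, ⟨⟨some v, rfl⟩⟩⟩
    rintro ⟨_, rfl⟩ ⟨_, rfl⟩
    exact SimpleGraph.Reachable.refl _
  · intro u v huv
    simpa using huv
  · intro u v h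
    refine ⟨some u, rfl, some v, rfl, ?_⟩
    rw [addEdge_adj'] at h ⊢
    rw [addV_some]
    simpa using h

theorem not_linkless_none {V : Type} (G : SimpleGraph V) (x y b : V)
    (hG : IsMaxnil G) (hnt : ∀ w : V, ¬ (G.Adj x w ∧ G.Adj y w))
    (hb : ¬ (addV G x y).Adj none (some b)) :
    ¬ IsLinkless (addEdge (addV G x y) none (some b)) := by
  rw [addV_none] at hb
  push Not at hb
  by_cases h : G.Adj x b
  · have h' : ¬ G.Adj b y := fun h' => hnt b ⟨h, h'.symm⟩
    rw [addV_comm]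
    exact not_linkless_of_minor (minor_contract G y x b) (hG.2 b y hb.2 h')
  · exact not_linkless_of_minor (minor_contract G x y b) (hG.2 b x hb.1 fun h' => h h'.symm)

/-- If `G` is maxnil and `xy` is a non-triangular edge of `G`, then the graph obtained
from `G` by adding one new vertex adjacent exactly to `x` and `y` is maxnil. -/
theorem stmt_7 {V : Type} [Fintype V] (G : SimpleGraph V) (x y : V)
    (hG : IsMaxnil G) (he : G.Adj x y) (hnt : ∀ w : V, ¬ (G.Adj x w ∧ G.Adj y w)) :
    IsMaxnil
      ((SimpleGraph.map Function.Embedding.some G) ⊔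
        SimpleGraph.fromEdgeSet {s((none : Option V), some x), s(none, some y)}) := by

  refine ⟨linkless_addV G x y hG.1 he, ?_⟩
  rintro (_ | a) (_ | b) hab hadj
  · exact absurd rfl hab
  · exact not_linkless_none G x y b hG hnt hadj
  · rw [addEdge_comm']
    exact not_linkless_none G x y a hG hnt fun h => hadj h.symm
  · have h1 : a ≠ b := fun h => hab (congrArg some h)
    have h2 : ¬ G.Adj a b := fun h => hadj ((addV_some G x y a b).2 h)
    exact not_linkless_of_minor (minor_some G x y a b) (hG.2 a b h1 h2)
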